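/- (Impossibility of simultaneous crossing.) Fix an adaptive measurement scheme with horizon t, disjoint sets S₀ and S₁ of density matrices on ℂ^d, null and alternative MLE maps ρ̂₀^s and ρ̂₁^s for all 0 ≤ s ≤ t, and assume Tr(ρ^{⊗n_i} M^i(h)_x) > 0 for every ρ ∈ S₀ ∪ S₁, round i, history h, and outcome x. Let Λ₀^t and Λ₁^t be the associated split likelihood ratio and reversed split likelihood ratio at time t. Then for any error thresholds ε₀, ε₁ ∈ (0,1), there is no outcome sequence x ∈ X^t with both Λ₀^t(x) ≥ 1/ε₀ and Λ₁^t(x) ≥ 1/ε₁. -/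

import Mathlib

open Matrix BigOperators
open scoped ComplexOrder

noncomputable section

/-- A density matrix on `ℂ^d`: positive semidefinite with trace 1. -/
def IsDensityMatrix {d : ℕ} (ρ : Matrix (Fin d) (Fin d) ℂ) : Prop :=
  ρ.PosSemidef ∧ ρ.trace = 1

/-- A POVM with finite outcome set `X`: positive semidefinite effects summing to the identity. -/
def IsPOVM {m : Type*} [Fintype m] [DecidableEq m] {X : Type*} [Fintype X]
    (M : X → Matrix m m ℂ) : Prop :=
  (∀ x, (M x).PosSemidef) ∧ ∑ x, M x = 1

/-- The `n`-fold tensor power of a `d × d` matrix, indexed by tuples in `Fin n → Fin d`,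
with entries `(ρ^{⊗n})_{x,y} = ∏ i, ρ (x i) (y i)`. -/
def tensorPow {d : ℕ} (ρ : Matrix (Fin d) (Fin d) ℂ) (n : ℕ) :
    Matrix (Fin n → Fin d) (Fin n → Fin d) ℂ :=
  fun x y => ∏ i, ρ (x i) (y i)

/-- Born probability `Tr(ρ M)` as the associated (nonnegative) real number. -/
def bornProb {m : Type*} [Fintype m] (ρ M : Matrix m m ℂ) : ℝ :=
  ((ρ * M).trace).re

/-- An adaptive measurement scheme with horizon `t`: at round `i` (0-based), given a
history `h ∈ X^i`, it measures `n i ≥ 1` fresh copies with the POVM `M i h`. -/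
structure AdaptiveScheme (d : ℕ) (X : Type*) [Fintype X] (t : ℕ) where
  n : Fin t → ℕ
  hn : ∀ i, 1 ≤ n i
  M : (i : Fin t) → (Fin i → X) → X →
        Matrix (Fin (n i) → Fin d) (Fin (n i) → Fin d) ℂ
  hM : ∀ i h, IsPOVM (M i h)

/-- The history (first `i` outcomes) of an outcome sequence `x`. -/
def hist {X : Type*} {t : ℕ} (x : Fin t → X) (i : Fin t) : Fin i → X :=
  fun j => x ⟨j, j.isLt.trans i.isLt⟩

/-- Probability of observing the outcome sequence `x` under state `ρ`. -/
def seqProb {d t : ℕ} {X : Type*} [Fintype X] (S : AdaptiveScheme d X t)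
    (ρ : Matrix (Fin d) (Fin d) ℂ) (x : Fin t → X) : ℝ :=
  ∏ i, bornProb (tensorPow ρ (S.n i)) (S.M i (hist x i) (x i))

/-- Likelihood of the first `s` outcomes of a history `h ∈ X^s` under state `ρ`:
`∏_{i=1}^{s} Tr(ρ^{⊗ n_i} M^i(h_1,…,h_{i-1})_{h_i})` (rounds beyond the horizon contribute 1). -/
def likOnHist {d t : ℕ} {X : Type*} [Fintype X] (S : AdaptiveScheme d X t)
    (ρ : Matrix (Fin d) (Fin d) ℂ) (s : ℕ) (h : Fin s → X) : ℝ :=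
  ∏ i : Fin t, if hi : (i : ℕ) < s then
    bornProb (tensorPow ρ (S.n i))
      (S.M i (fun j => h ⟨j, j.isLt.trans hi⟩) (h ⟨i, hi⟩))
  else 1

/-- An MLE map for the class `S₀`: at each time `s ≤ t` and history `h ∈ X^s`, it returns a
state of `S₀` maximizing the likelihood of `h` over `S₀`. -/
def IsMLEMap {d t : ℕ} {X : Type*} [Fintype X] (S : AdaptiveScheme d X t)
    (S₀ : Set (Matrix (Fin d) (Fin d) ℂ))
    (est : (s : ℕ) → (Fin s → X) → Matrix (Fin d) (Fin d) ℂ) : Prop :=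
  ∀ s : ℕ, s ≤ t → ∀ h : Fin s → X,
    est s h ∈ S₀ ∧ ∀ ρ' ∈ S₀, likOnHist S ρ' s h ≤ likOnHist S (est s h) s h

/-- The split likelihood ratio at time `s ≤ t`:
`Λ₀^s(x) = ∏_{i=1}^{s} Tr((ρ̂₁^{i-1}(x_{<i}))^{⊗n_i} M^i_{x_i}) / Tr((ρ̂₀^{s}(x_{≤s}))^{⊗n_i} M^i_{x_i})`,
with non-anticipating alternative MLEs in the numerator and the time-`s` null MLE in the
denominator. -/
def slr₀ {d t : ℕ} {X : Type*} [Fintype X] (S : AdaptiveScheme d X t)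
    (est₀ est₁ : (s : ℕ) → (Fin s → X) → Matrix (Fin d) (Fin d) ℂ)
    (x : Fin t → X) (s : ℕ) (hs : s ≤ t) : ℝ :=
  ∏ i : Fin t, if (i : ℕ) < s then
    bornProb (tensorPow (est₁ i (hist x i)) (S.n i)) (S.M i (hist x i) (x i)) /
      bornProb (tensorPow (est₀ s (fun j => x (Fin.castLE hs j))) (S.n i))
        (S.M i (hist x i) (x i))
  else 1

/-- The reversed split likelihood ratio at time `s ≤ t`, exchanging the roles of the null and
alternative hypotheses:
`Λ₁^s(x) = ∏_{i=1}^{s} Tr((ρ̂₀^{i-1}(x_{<i}))^{⊗n_i} M^i_{x_i}) / Tr((ρ̂₁^{s}(x_{≤s}))^{⊗n_i} M^i_{x_i})`. -/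
def slr₁ {d t : ℕ} {X : Type*} [Fintype X] (S : AdaptiveScheme d X t)
    (est₀ est₁ : (s : ℕ) → (Fin s → X) → Matrix (Fin d) (Fin d) ℂ)
    (x : Fin t → X) (s : ℕ) (hs : s ≤ t) : ℝ :=
  ∏ i : Fin t, if (i : ℕ) < s then
    bornProb (tensorPow (est₀ i (hist x i)) (S.n i)) (S.M i (hist x i) (x i)) /
      bornProb (tensorPow (est₁ s (fun j => x (Fin.castLE hs j))) (S.n i))
        (S.M i (hist x i) (x i))
  else 1

/-- Likelihood of the outcome `x i` of round `i`, given the preceding outcomes. -/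
def roundProb {d t : ℕ} {X : Type*} [Fintype X] (S : AdaptiveScheme d X t)
    (x : Fin t → X) (ρ : Matrix (Fin d) (Fin d) ℂ) (i : Fin t) : ℝ :=
  bornProb (tensorPow ρ (S.n i)) (S.M i (hist x i) (x i))

theorem likOnHist_castLE {d t : ℕ} {X : Type*} [Fintype X] (S : AdaptiveScheme d X t)
    (ρ : Matrix (Fin d) (Fin d) ℂ) (x : Fin t → X) {s : ℕ} (hs : s ≤ t) :
    likOnHist S ρ s (fun j => x (Fin.castLE hs j)) =
      ∏ i : Fin t, if (i : ℕ) < s then roundProb S x ρ i else 1 := by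
  refine Finset.prod_congr rfl fun i _ => ?_
  split_ifs <;> rfl

theorem prod_ite_lt_succ {M : Type*} [CommMonoid M] {t s : ℕ} (hs : s < t) (f : Fin t → M) :
    (∏ i : Fin t, if (i : ℕ) < s + 1 then f i else 1) =
      (∏ i : Fin t, if (i : ℕ) < s then f i else 1) * f ⟨s, hs⟩ := by
  have h : f ⟨s, hs⟩ = ∏ i : Fin t, if i = ⟨s, hs⟩ then f i else 1 := by simp
  rw [h, ← Finset.prod_mul_distrib]
  refine Finset.prod_congr rfl fun i _ => ?_
  rcases lt_trichotomy (i : ℕ) s with hi | hi | hi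
  · simp [hi, Nat.lt_succ_of_lt hi, Fin.ext_iff, hi.ne]
  · simp [hi, Fin.ext_iff]
  · simp [hi.not_gt, Fin.ext_iff, hi.ne', Nat.not_lt.mpr (Nat.succ_le_of_lt hi)]

/-- The likelihood accumulated by the running MLEs is at most the final maximum likelihood. -/
theorem prod_running_mle_le {d t : ℕ} {X : Type*} [Fintype X] (S : AdaptiveScheme d X t)
    {S₀ : Set (Matrix (Fin d) (Fin d) ℂ)}
    {est : (s : ℕ) → (Fin s → X) → Matrix (Fin d) (Fin d) ℂ} (hest : IsMLEMap S S₀ est)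
    (x : Fin t → X) (hnonneg : ∀ ρ ∈ S₀, ∀ i, 0 ≤ roundProb S x ρ i) (s : ℕ) (hs : s ≤ t) :
    (∏ i : Fin t, if (i : ℕ) < s then roundProb S x (est i (hist x i)) i else 1) ≤
      ∏ i : Fin t, if (i : ℕ) < s then
        roundProb S x (est s (fun j => x (Fin.castLE hs j))) i else 1 := by
  induction s with
  | zero => simp
  | succ s ih =>
    have hs' : s ≤ t := Nat.le_of_succ_le hs
    have hmem := (hest s hs' fun j => x (Fin.castLE hs' j)).1
    have hmax := (hest (s + 1) hs fun j => x (Fin.castLE hs j)).2 _ hmem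
    rw [likOnHist_castLE, likOnHist_castLE] at hmax
    refine le_trans ?_ hmax
    rw [prod_ite_lt_succ hs, prod_ite_lt_succ hs]
    exact mul_le_mul_of_nonneg_right (ih hs') (hnonneg _ hmem _)

/-- impossibility of simultaneous crossing — no outcome sequence can make both
the split likelihood ratio and the reversed split likelihood ratio cross their respective
thresholds. -/
theorem no_simultaneous_crossing {d t : ℕ} {X : Type*} [Fintype X]
    (ht : 1 ≤ t) (S : AdaptiveScheme d X t)
    (S₀ S₁ : Set (Matrix (Fin d) (Fin d) ℂ)) (hdisj : Disjoint S₀ S₁)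
    (hS₀ : ∀ ρ' ∈ S₀, IsDensityMatrix ρ') (hS₁ : ∀ ρ' ∈ S₁, IsDensityMatrix ρ')
    (est₀ est₁ : (s : ℕ) → (Fin s → X) → Matrix (Fin d) (Fin d) ℂ)
    (h₀ : IsMLEMap S S₀ est₀) (h₁ : IsMLEMap S S₁ est₁)
    (hpos : ∀ ρ' ∈ S₀ ∪ S₁, ∀ (i : Fin t) (h : Fin i → X) (x : X),
      0 < bornProb (tensorPow ρ' (S.n i)) (S.M i h x))
    (ε₀ ε₁ : ℝ) (hε₀ : ε₀ ∈ Set.Ioo (0 : ℝ) 1) (hε₁ : ε₁ ∈ Set.Ioo (0 : ℝ) 1) :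
    ¬ ∃ x : Fin t → X,
        1 / ε₀ ≤ slr₀ S est₀ est₁ x t le_rfl ∧ 1 / ε₁ ≤ slr₁ S est₀ est₁ x t le_rfl := by
  rintro ⟨x, hx₀, hx₁⟩
  have pos₀ : ∀ ρ ∈ S₀, ∀ i, 0 < roundProb S x ρ i := fun ρ hρ i => hpos ρ (.inl hρ) i _ _
  have pos₁ : ∀ ρ ∈ S₁, ∀ i, 0 < roundProb S x ρ i := fun ρ hρ i => hpos ρ (.inr hρ) i _ _
  have le₀ := prod_running_mle_le S h₀ x (fun ρ hρ i => (pos₀ ρ hρ i).le) t le_rfl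
  have le₁ := prod_running_mle_le S h₁ x (fun ρ hρ i => (pos₁ ρ hρ i).le) t le_rfl
  simp only [Fin.is_lt, if_true] at le₀ le₁
  have P₀ := Finset.prod_pos fun i (_ : i ∈ Finset.univ) =>
    pos₀ _ (h₀ t le_rfl fun j => x (Fin.castLE le_rfl j)).1 i
  have P₁ := Finset.prod_pos fun i (_ : i ∈ Finset.univ) =>
    pos₁ _ (h₁ t le_rfl fun j => x (Fin.castLE le_rfl j)).1 i
  simp only [slr₀, slr₁, Fin.is_lt, if_true, Finset.prod_div_distrib] at hx₀ hx₁
  have lt₀ := (one_lt_one_div hε₀.1 hε₀.2).trans_le hx₀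
  have lt₁ := (one_lt_one_div hε₁.1 hε₁.2).trans_le hx₁
  have gt₀ := (one_lt_div P₀).1 lt₀
  have gt₁ := (one_lt_div P₁).1 lt₁
  exact lt_irrefl _ (((gt₀.trans_le le₁).trans gt₁).trans_le le₀)
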